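/- arXiv:2211.14707 — 3 statements merged into one kernel-verified Lean document; each statement's English description precedes it below -/
import Mathlib

section
/- If P is a moderately meet continuous quasiexact dcpo and the relation ≪_w on P is weakly increasing, then P is a domain, i.e., for every x ∈ P the set {y ∈ P : y ≪ x} is directed and its supremum is x. -/
open Set TopologicalSpace

variable {α : Type*}

/-- The upper closure `↑A = {p : ∃ a ∈ A, a ≤ p}`. -/
def upSet [PartialOrder α] (A : Set α) : Set α := {p | ∃ a ∈ A, a ≤ p}

/-- The lower closure `↓A = {p : ∃ a ∈ A, p ≤ a}`. -/
def downSet [PartialOrder α] (A : Set α) : Set α := {p | ∃ a ∈ A, p ≤ a}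

/-- A nonempty subset `D` is directed if every two elements have an upper bound in `D`. -/
def IsDirectedSet [PartialOrder α] (D : Set α) : Prop :=
  D.Nonempty ∧ ∀ a ∈ D, ∀ b ∈ D, ∃ c ∈ D, a ≤ c ∧ b ≤ c

/-- `G` is weakly way below `H` (`G ≪_w H`): for every directed `D` whose sup exists,
`sup D ∈ H` implies `d ∈ ↑G` for some `d ∈ D`. -/
def WWB [PartialOrder α] (G H : Set α) : Prop :=
  ∀ D : Set α, IsDirectedSet D → ∀ s : α, IsLUB D s → s ∈ H → ∃ d ∈ D, d ∈ upSet G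

/-- `↟_w G = {a : G ≪_w a}`. -/
def wUp [PartialOrder α] (G : Set α) : Set α := {a | WWB G {a}}

/-- `fin_w(x)`: all finite nonempty subsets `F` with `F ≪_w x`. -/
def finW [PartialOrder α] (x : α) : Set (Set α) :=
  {F | F.Finite ∧ F.Nonempty ∧ WWB F {x}}

/-- `fin_(bl)w(x) = {F ∈ fin_w(x) : F ⊆ ↓x}`. -/
def finBlW [PartialOrder α] (x : α) : Set (Set α) :=
  {F | F ∈ finW x ∧ F ⊆ downSet {x}}

/-- A family `𝓕` of subsets is directed if for `F₁, F₂ ∈ 𝓕` there is `F₃ ∈ 𝓕`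
with `F₃ ⊆ ↑F₁ ∩ ↑F₂`. -/
def DirectedFam [PartialOrder α] (𝓕 : Set (Set α)) : Prop :=
  ∀ F₁ ∈ 𝓕, ∀ F₂ ∈ 𝓕, ∃ F₃ ∈ 𝓕, F₃ ⊆ upSet F₁ ∩ upSet F₂

/-- `P` is quasiexact if for each `x` the family `fin_w(x)` is directed and
`⋂ {↑F : F ∈ fin_w(x)} = ↑x`. -/
def Quasiexact (α : Type*) [PartialOrder α] : Prop :=
  ∀ x : α, DirectedFam (finW x) ∧ (⋂ F ∈ finW x, upSet F) = upSet {x}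

/-- A dcpo: every directed subset has a supremum. -/
def IsDcpo (α : Type*) [PartialOrder α] : Prop :=
  ∀ D : Set α, IsDirectedSet D → ∃ s : α, IsLUB D s

/-- The wf topology: generated by the subbasis `{↟_w F : F finite nonempty}`. -/
def wfTopology (α : Type*) [PartialOrder α] : TopologicalSpace α :=
  generateFrom {U | ∃ F : Set α, F.Finite ∧ F.Nonempty ∧ U = wUp F}

/-- The wwb topology: generated by the subbasis `{↟_w x : x ∈ P}`. -/
def wwbTopology (α : Type*) [PartialOrder α] : TopologicalSpace α :=
  generateFrom {U | ∃ x : α, U = wUp {x}}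

/-- `P` is moderately meet continuous: `x ≤ sup D` implies
`x ∈ cl_{τ_wf}(↓D ∩ ↓x)` for every directed `D` whose sup exists. -/
def ModMeetCont (α : Type*) [PartialOrder α] : Prop :=
  ∀ x : α, ∀ D : Set α, IsDirectedSet D → ∀ s : α, IsLUB D s → x ≤ s →
    x ∈ @closure α (wfTopology α) (downSet D ∩ downSet {x})

/-- `U` is Scott open: `U = ↑U` and every directed set whose sup lies in `U` meets `U`. -/
def IsScottOpen [PartialOrder α] (U : Set α) : Prop :=
  upSet U = U ∧
    ∀ D : Set α, IsDirectedSet D → ∀ s : α, IsLUB D s → s ∈ U → (D ∩ U).Nonempty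

/-- The Scott topology. -/
def scottTopology (α : Type*) [PartialOrder α] : TopologicalSpace α :=
  generateFrom {U | IsScottOpen U}

/-- `P` is exact: for every `x` the set `{y : y ≪_w x}` is directed with supremum `x`. -/
def ExactPoset (α : Type*) [PartialOrder α] : Prop :=
  ∀ x : α, IsDirectedSet {y | WWB {y} {x}} ∧ IsLUB {y | WWB {y} {x}} x

/-- `x` is way below `y`: for every directed `D` whose sup exists,
`y ≤ sup D` implies `x ≤ d` for some `d ∈ D`. -/
def WayBelowPt [PartialOrder α] (x y : α) : Prop :=
  ∀ D : Set α, IsDirectedSet D → ∀ s : α, IsLUB D s → y ≤ s → ∃ d ∈ D, x ≤ d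

/-- `G` is way below `H`: for every directed `D` whose sup exists,
`sup D ∈ ↑H` implies `d ∈ ↑G` for some `d ∈ D`. -/
def WayBelowSet [PartialOrder α] (G H : Set α) : Prop :=
  ∀ D : Set α, IsDirectedSet D → ∀ s : α, IsLUB D s → s ∈ upSet H → ∃ d ∈ D, d ∈ upSet G

/-- `fin(x)`: all finite nonempty subsets `F` with `F ≪ x`. -/
def finWB [PartialOrder α] (x : α) : Set (Set α) :=
  {F | F.Finite ∧ F.Nonempty ∧ WayBelowSet F {x}}

/-- The relation `≪_w` is weakly increasing: `x ≪_w y ≤ z ≪_w u` implies `x ≪_w z`. -/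
def WeaklyIncreasing (α : Type*) [PartialOrder α] : Prop :=
  ∀ x y z u : α, WWB {x} {y} → y ≤ z → WWB {z} {u} → WWB {x} {z}

/-- In a moderately meet continuous poset, if `F ≪_w z` and `z ≤ sup D`, then `F ≪_w w` for
some `w ≤ z` in `↓D`. -/
lemma ModMeetCont.exists_wwb_le [PartialOrder α] (hmmc : ModMeetCont α) {F : Set α}
    (hF : F.Finite) (hne : F.Nonempty) {z s : α} (hz : WWB F {z}) {D : Set α}
    (hD : IsDirectedSet D) (hs : IsLUB D s) (hzs : z ≤ s) :
    ∃ w ≤ z, WWB F {w} ∧ ∃ d ∈ D, w ≤ d := by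
  let := wfTopology α
  have hopen : IsOpen (wUp F) := isOpen_generateFrom_of_mem ⟨F, hF, hne, rfl⟩
  obtain ⟨w, hwF, ⟨d, hd, hwd⟩, v, rfl, hwz⟩ :=
    mem_closure_iff.1 (hmmc z D hD s hs hzs) (wUp F) hopen hz
  exact ⟨w, hwz, hwF, d, hd, hwd⟩

lemma isDirectedSet_singleton [PartialOrder α] (x : α) : IsDirectedSet {x} :=
  ⟨singleton_nonempty x, by rintro a rfl b rfl; exact ⟨_, rfl, le_rfl, le_rfl⟩⟩

lemma WWB.mem_upSet [PartialOrder α] {F : Set α} {x : α} (h : WWB F {x}) : x ∈ upSet F := by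
  obtain ⟨d, rfl, hd⟩ := h {x} (isDirectedSet_singleton x) x isLUB_singleton rfl
  exact hd

lemma WayBelowPt.le [PartialOrder α] {x y : α} (h : WayBelowPt x y) : x ≤ y := by
  obtain ⟨d, rfl, hd⟩ := h {y} (isDirectedSet_singleton y) y isLUB_singleton le_rfl
  exact hd

lemma WayBelowPt.singleton_mem_finW [PartialOrder α] {x y : α} (h : WayBelowPt y x) :
    {y} ∈ finW x := by
  refine ⟨finite_singleton y, singleton_nonempty y, fun D hD s hs hsx => ?_⟩
  obtain ⟨d, hdD, hyd⟩ := h D hD s hs (mem_singleton_iff.1 hsx).ge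
  exact ⟨d, hdD, y, rfl, hyd⟩

/-- In a moderately meet continuous poset, if `F ≪_w x` and no element of the finite set `S` is
way below `x`, then `F ≪_w w` for some `w ≤ x` lying above no element of `S`. -/
lemma ModMeetCont.exists_wwb_forall_not_le [PartialOrder α] (hmmc : ModMeetCont α) {F : Set α}
    (hF : F.Finite) (hne : F.Nonempty) {x : α} (hx : WWB F {x}) {S : Set α} (hS : S.Finite)
    (hSx : ∀ u ∈ S, ¬ WayBelowPt u x) :
    ∃ w ≤ x, WWB F {w} ∧ ∀ u ∈ S, ¬ u ≤ w := by
  induction S, hS using Set.Finite.induction_on with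
  | empty => exact ⟨x, le_rfl, hx, by simp⟩
  | @insert a S _ _ ih =>
    obtain ⟨z, hzx, hz, hzS⟩ := ih fun u hu => hSx u (mem_insert_of_mem a hu)
    have ha := hSx a (mem_insert a S)
    unfold WayBelowPt at ha
    push Not at ha
    obtain ⟨D, hD, s, hs, hxs, haD⟩ := ha
    obtain ⟨w, hwz, hw, d, hd, hwd⟩ := hmmc.exists_wwb_le hF hne hz hD hs (hzx.trans hxs)
    refine ⟨w, hwz.trans hzx, hw, ?_⟩
    rintro u (rfl | hu) huw
    · exact haD d hd (huw.trans hwd)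
    · exact hzS u hu (huw.trans hwz)

lemma ModMeetCont.exists_wayBelowPt [PartialOrder α] (hmmc : ModMeetCont α) {F : Set α} {x : α}
    (hF : F ∈ finW x) : ∃ u ∈ F, WayBelowPt u x := by
  obtain ⟨hfin, hne, hx⟩ := hF
  by_contra! h
  obtain ⟨w, -, hw, hwF⟩ := hmmc.exists_wwb_forall_not_le hfin hne hx hfin h
  obtain ⟨u, hu, huw⟩ := hw.mem_upSet
  exact hwF u hu huw

lemma Quasiexact.finW_nonempty [PartialOrder α] (hqe : Quasiexact α) (x : α) :
    (finW x).Nonempty := by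
  by_contra! h
  have hbot := (hqe x).2
  simp only [h, mem_empty_iff_false, iInter_of_empty, iInter_univ] at hbot
  have hxx : WayBelowPt x x := by
    intro D hD _ _ _
    obtain ⟨d, hd⟩ := hD.1
    obtain ⟨v, rfl, hvd⟩ := hbot.subset (mem_univ d)
    exact ⟨d, hd, hvd⟩
  exact (h.subset hxx.singleton_mem_finW).elim

/-- A moderately meet continuous quasiexact dcpo with `≪_w` weakly
increasing is a domain. -/
theorem moderately_meet_continuous_quasiexact_weakly_increasing_is_domain
    [PartialOrder α] (hd : IsDcpo α) (hqe : Quasiexact α) (hmmc : ModMeetCont α)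
    (hwi : WeaklyIncreasing α) :
    ∀ x : α, IsDirectedSet {y | WayBelowPt y x} ∧ IsLUB {y | WayBelowPt y x} x := by
  intro x
  refine ⟨⟨?_, fun a ha b hb => ?_⟩, fun y hy => hy.le, fun b hb => ?_⟩
  · obtain ⟨F, hF⟩ := hqe.finW_nonempty x
    obtain ⟨u, -, hu⟩ := hmmc.exists_wayBelowPt hF
    exact ⟨u, hu⟩
  · obtain ⟨F, hF, hFsub⟩ := (hqe x).1 {a} ha.singleton_mem_finW {b} hb.singleton_mem_finW
    obtain ⟨u, huF, hu⟩ := hmmc.exists_wayBelowPt hF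
    obtain ⟨⟨_, rfl, hau⟩, ⟨_, rfl, hbu⟩⟩ := hFsub huF
    exact ⟨u, hu, hau, hbu⟩
  · have hbF : b ∈ ⋂ F ∈ finW x, upSet F := by
      refine mem_iInter₂.2 fun F hF => ?_
      obtain ⟨u, huF, hu⟩ := hmmc.exists_wayBelowPt hF
      exact ⟨u, huF, hb hu⟩
    rw [(hqe x).2] at hbF
    obtain ⟨_, rfl, hxb⟩ := hbF
    exact hxb
end

section
/- A dcpo P is quasiexact if and only if for every x ∈ P the family fin_(bl)w(x) is directed and ⋂{↑F : F ∈ fin_(bl)w(x)} = ↑x. -/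
open Set TopologicalSpace

variable {α : Type*}

theorem upSet_mono [PartialOrder α] {A B : Set α} (h : A ⊆ B) : upSet A ⊆ upSet B :=
  fun _ ⟨a, ha, hap⟩ => ⟨a, h ha, hap⟩

/-- Discarding the elements of `F ∈ fin_w(x)` that are not below `x` gives a member of
`fin_(bl)w(x)`. -/
theorem inter_downSet_mem_finBlW [PartialOrder α] {x : α} {F : Set α} (hF : F ∈ finW x) :
    F ∩ downSet {x} ∈ finBlW x := by
  obtain ⟨hfin, -, hw⟩ := hF
  have hw' : WWB (F ∩ downSet {x}) {x} := by
    rintro D hD s hs rfl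
    obtain ⟨d, hd, f, hf, hfd⟩ := hw D hD s hs rfl
    exact ⟨d, hd, f, ⟨hf, s, rfl, hfd.trans (hs.1 hd)⟩, hfd⟩
  obtain ⟨-, -, f, hf, -⟩ := hw' {x} ⟨singleton_nonempty x, by simp⟩ x isLUB_singleton rfl
  exact ⟨⟨hfin.subset inter_subset_left, ⟨f, hf⟩, hw'⟩, inter_subset_right⟩

theorem directedFam_finW_iff [PartialOrder α] (x : α) :
    DirectedFam (finW x) ↔ DirectedFam (finBlW x) := by
  constructor
  · intro h F₁ h₁ F₂ h₂
    obtain ⟨F₃, h₃, hsub⟩ := h F₁ h₁.1 F₂ h₂.1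
    exact ⟨_, inter_downSet_mem_finBlW h₃, inter_subset_left.trans hsub⟩
  · intro h F₁ h₁ F₂ h₂
    obtain ⟨F₃, h₃, hsub⟩ :=
      h _ (inter_downSet_mem_finBlW h₁) _ (inter_downSet_mem_finBlW h₂)
    exact ⟨F₃, h₃.1, hsub.trans
      (inter_subset_inter (upSet_mono inter_subset_left) (upSet_mono inter_subset_left))⟩

theorem iInter_upSet_finW_eq [PartialOrder α] (x : α) :
    (⋂ F ∈ finW x, upSet F) = ⋂ F ∈ finBlW x, upSet F := by
  apply Subset.antisymm
  · exact biInter_mono (fun _ hF => hF.1) fun _ _ => Subset.rfl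
  · exact subset_iInter₂ fun F hF =>
      (biInter_subset_of_mem (inter_downSet_mem_finBlW hF)).trans (upSet_mono inter_subset_left)

/-- A dcpo is quasiexact iff for every `x` the family `fin_(bl)w(x)`
is directed and `⋂ {↑F : F ∈ fin_(bl)w(x)} = ↑x`. -/
theorem quasiexact_iff_finBlW_directed_and_inter_eq [PartialOrder α]
    (hd : IsDcpo α) :
    Quasiexact α ↔
      ∀ x : α, DirectedFam (finBlW x) ∧ (⋂ F ∈ finBlW x, upSet F) = upSet {x} := by
  simp only [Quasiexact, directedFam_finW_iff, iInter_upSet_finW_eq]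
end

section
/- If P is a moderately meet continuous quasiexact poset and F is a finite nonempty subset of P, then ↟_w F = ⋃{↟_w x : x ∈ F} = Int_{τ_wf}(↑F), where the interior is taken in the wf topology. -/
open Set TopologicalSpace

variable {α : Type*}

theorem wUp_subset_upSet [PartialOrder α] (F : Set α) : wUp F ⊆ upSet F := by
  intro y hy
  obtain ⟨d, rfl, hd⟩ := hy {y} ⟨singleton_nonempty y, by simp⟩ y isLUB_singleton rfl
  exact hd

theorem wUp_mono [PartialOrder α] {F G : Set α} (h : F ⊆ G) : wUp F ⊆ wUp G := by
  intro y hy D hD s hs hsy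
  obtain ⟨d, hd, x, hx, hxd⟩ := hy D hD s hs hsy
  exact ⟨d, hd, x, h hx, hxd⟩

theorem isOpen_wUp [PartialOrder α] {F : Set α} (hF : F.Finite) (hFne : F.Nonempty) :
    @IsOpen α (wfTopology α) (wUp F) :=
  isOpen_generateFrom_of_mem ⟨F, hF, hFne, rfl⟩

/-- A wf-open neighbourhood of `y` contains a point below `y` that avoids the upper closure of
any given finite set none of whose elements is weakly way below `y`. -/
theorem ModMeetCont.exists_mem_le_forall_not_le [PartialOrder α] (hmmc : ModMeetCont α)
    {G U : Set α} {y : α} (hG : G.Finite) (hU : @IsOpen α (wfTopology α) U) (hy : y ∈ U)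
    (h : ∀ x ∈ G, y ∉ wUp {x}) : ∃ z ∈ U, z ≤ y ∧ ∀ x ∈ G, ¬ x ≤ z := by
  induction G, hG using Set.Finite.induction_on with
  | empty => exact ⟨y, hy, le_rfl, by simp⟩
  | @insert a G _ _ ih =>
    obtain ⟨z, hzU, hzy, hz⟩ := ih fun x hx => h x (mem_insert_of_mem a hx)
    have ha : ¬ WWB {a} {y} := h a (mem_insert a G)
    simp only [WWB, not_forall] at ha
    obtain ⟨D, hD, s, hs, rfl, hDa⟩ := ha
    obtain ⟨w, hwU, ⟨d, hd, hwd⟩, _, rfl, hwz⟩ :=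
      (@mem_closure_iff α (wfTopology α) _ _).1 (hmmc z D hD _ hs hzy) U hU hzU
    refine ⟨w, hwU, hwz.trans hzy, ?_⟩
    rintro x (rfl | hx) hxw
    · exact hDa ⟨d, hd, x, rfl, hxw.trans hwd⟩
    · exact hz x hx (hxw.trans hwz)

theorem ModMeetCont.interior_upSet_subset [PartialOrder α] (hmmc : ModMeetCont α)
    {F : Set α} (hF : F.Finite) :
    @interior α (wfTopology α) (upSet F) ⊆ ⋃ x ∈ F, wUp {x} := by
  intro y hy
  by_contra hcon
  obtain ⟨z, hz, _, hFz⟩ := hmmc.exists_mem_le_forall_not_le hF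
    (@isOpen_interior α (wfTopology α) (upSet F)) hy
    fun x hx hxy => hcon (mem_biUnion hx hxy)
  obtain ⟨x, hx, hxz⟩ := @interior_subset α (wfTopology α) _ _ hz
  exact hFz x hx hxz

/-- In a moderately meet continuous quasiexact poset,
`↟_w F = ⋃ {↟_w x : x ∈ F} = Int_{τ_wf}(↑F)` for finite nonempty `F`. -/
theorem wUp_eq_union_eq_wf_interior [PartialOrder α] (hmmc : ModMeetCont α)
    (hq : Quasiexact α) (F : Set α) (hF : F.Finite) (hFne : F.Nonempty) :
    wUp F = (⋃ x ∈ F, wUp {x}) ∧ wUp F = @interior α (wfTopology α) (upSet F) := by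
  have hunion : (⋃ x ∈ F, wUp {x}) ⊆ wUp F :=
    iUnion₂_subset fun x hx => wUp_mono (singleton_subset_iff.2 hx)
  have hinterior : wUp F ⊆ @interior α (wfTopology α) (upSet F) :=
    @interior_maximal α (wfTopology α) _ _ (wUp_subset_upSet F) (isOpen_wUp hF hFne)
  have hsub := hmmc.interior_upSet_subset hF
  exact ⟨(hinterior.trans hsub).antisymm hunion, hinterior.antisymm (hsub.trans hunion)⟩
end
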